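/- Let a₁, b₁ be reals with 0 < a₁ ≤ b₁, let (a_k, b_k) be the restriction intervals and (c⁽ᵏ⁾) the adaptivity sequence. Let n, N ≥ 1 and, for each worker j ∈ {1,…,N} and each k ≥ 0, let w_j⁽ᵏ⁾ : Fin n → ℝ be weight vectors whose entries lie in [a_k, b_k] for k ≥ 1, with w_j⁽⁰⁾ = w_j⁽¹⁾. Then for every k ≥ 1 and every pair of triples y = (u, v, λ), y′ = (u′, v′, λ′) with v, v′ ∈ ℝⁿ and λ_j, λ′_j ∈ ℝⁿ, one has ‖y − y′‖²_{T⁽ᵏ⁾} ≤ (1 + c⁽ᵏ⁾)·‖y − y′‖²_{T⁽ᵏ⁻¹⁾}, i.e., ∑_{j=1}^N ‖v − v′‖²_{w_j⁽ᵏ⁾} + ∑_{j=1}^N ‖λ_j − λ′_j‖²_{1/w_j⁽ᵏ⁾} ≤ (1 + c⁽ᵏ⁾)·(∑_{j=1}^N ‖v − v′‖²_{w_j⁽ᵏ⁻¹⁾} + ∑_{j=1}^N ‖λ_j − λ′_j‖²_{1/w_j⁽ᵏ⁻¹⁾}). -/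

import Mathlib

/-- Upper endpoint of the restriction interval at step `k`:
`b_k = a₁ * ((1/k²)·(b₁/a₁) + 1 − 1/k²)`. -/
noncomputable def bEnd (a₁ b₁ : ℝ) (k : ℕ) : ℝ :=
  a₁ * ((1 / (k : ℝ) ^ 2) * (b₁ / a₁) + 1 - 1 / (k : ℝ) ^ 2)

/-- Adaptivity sequence: `c⁽¹⁾ = b₁/a₁ − 1` and `c⁽ᵏ⁾ = b_{k−1}/a₁ − 1` for `k > 1`. -/
noncomputable def cSeq (a₁ b₁ : ℝ) (k : ℕ) : ℝ :=
  if k = 1 then b₁ / a₁ - 1 else bEnd a₁ b₁ (k - 1) / a₁ - 1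

/-- Weighted squared norm `‖x‖²_w = ∑ᵢ wᵢ·xᵢ²`. -/
noncomputable def wnormSq {n : ℕ} (w x : Fin n → ℝ) : ℝ := ∑ i, w i * x i ^ 2

/-- `T`-seminorm (squared) of a triple `y = (u, v, λ)` determined by the weights
`w_j`: `‖y‖²_T = ∑_j ‖v‖²_{w_j} + ∑_j ‖λ_j‖²_{1/w_j}` (the `u`-block carries zero
weight). -/
noncomputable def TnormSq {n N : ℕ} (w : Fin N → Fin n → ℝ)
    (v : Fin n → ℝ) (lam : Fin N → Fin n → ℝ) : ℝ :=
  (∑ j, wnormSq (w j) v) + ∑ j, wnormSq (fun i => 1 / w j i) (lam j)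

theorem wnormSq_le_mul {n : ℕ} {w w' : Fin n → ℝ} {C : ℝ} (h : ∀ i, w i ≤ C * w' i)
    (x : Fin n → ℝ) : wnormSq w x ≤ C * wnormSq w' x := by
  unfold wnormSq
  rw [Finset.mul_sum]
  refine Finset.sum_le_sum fun i _ => ?_
  rw [← mul_assoc]
  exact mul_le_mul_of_nonneg_right (h i) (sq_nonneg _)

/-- If two families of weights take values in `[a, b]` with `0 < a`, the corresponding squared
seminorms differ by a factor of at most `b / a`. -/
theorem TnormSq_le_div_mul {n N : ℕ} {w w' : Fin N → Fin n → ℝ} {a b : ℝ} (ha : 0 < a)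
    (hw : ∀ j i, w j i ∈ Set.Icc a b) (hw' : ∀ j i, w' j i ∈ Set.Icc a b)
    (v : Fin n → ℝ) (lam : Fin N → Fin n → ℝ) :
    TnormSq w v lam ≤ b / a * TnormSq w' v lam := by
  have key : ∀ x ∈ Set.Icc a b, ∀ y ∈ Set.Icc a b, x ≤ b / a * y := by
    rintro x ⟨hx, hxb⟩ y ⟨hy, -⟩
    rw [div_mul_eq_mul_div, le_div_iff₀ ha]
    exact mul_le_mul hxb hy ha.le (ha.le.trans (hx.trans hxb))
  unfold TnormSq
  rw [mul_add, Finset.mul_sum, Finset.mul_sum]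
  refine add_le_add (Finset.sum_le_sum fun j _ => wnormSq_le_mul (fun i => ?_) _)
    (Finset.sum_le_sum fun j _ => wnormSq_le_mul (fun i => ?_) _)
  · exact key _ (hw j i) _ (hw' j i)
  · have hpos : 0 < w j i := ha.trans_le (hw j i).1
    have hpos' : 0 < w' j i := ha.trans_le (hw' j i).1
    rw [mul_one_div, div_le_div_iff₀ hpos hpos', one_mul]
    exact key _ (hw' j i) _ (hw j i)

theorem bEnd_one {a₁ : ℝ} (b₁ : ℝ) (ha : 0 < a₁) : bEnd a₁ b₁ 1 = b₁ := by
  simp [bEnd, mul_div_cancel₀, ha.ne']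

theorem bEnd_eq {a₁ : ℝ} (b₁ : ℝ) (ha : 0 < a₁) (k : ℕ) :
    bEnd a₁ b₁ k = a₁ + (b₁ - a₁) * (1 / (k : ℝ) ^ 2) := by
  have h : a₁ * (b₁ / a₁) = b₁ := mul_div_cancel₀ b₁ ha.ne'
  unfold bEnd
  linear_combination (1 / (k : ℝ) ^ 2) * h

theorem bEnd_le_bEnd {a₁ b₁ : ℝ} (ha : 0 < a₁) (hab : a₁ ≤ b₁) {k l : ℕ} (hk : 1 ≤ k)
    (hkl : k ≤ l) : bEnd a₁ b₁ l ≤ bEnd a₁ b₁ k := by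
  rw [bEnd_eq b₁ ha, bEnd_eq b₁ ha]
  have hk' : (0 : ℝ) < k := by exact_mod_cast hk
  have := sub_nonneg.2 hab
  gcongr

/-- `‖y − y′‖²_{T⁽ᵏ⁾} ≤ (1 + c⁽ᵏ⁾)·‖y − y′‖²_{T⁽ᵏ⁻¹⁾}`. -/
theorem stmt7 (a₁ b₁ : ℝ) (ha : 0 < a₁) (hab : a₁ ≤ b₁)
    (n N : ℕ) (hn : 1 ≤ n) (hN : 1 ≤ N)
    (w : ℕ → Fin N → Fin n → ℝ)
    (hw : ∀ k : ℕ, 1 ≤ k → ∀ j i, w k j i ∈ Set.Icc a₁ (bEnd a₁ b₁ k))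
    (hw0 : w 0 = w 1) :
    ∀ k : ℕ, 1 ≤ k → ∀ (v v' : Fin n → ℝ) (lam lam' : Fin N → Fin n → ℝ),
      TnormSq (w k) (v - v') (lam - lam') ≤
        (1 + cSeq a₁ b₁ k) * TnormSq (w (k - 1)) (v - v') (lam - lam') := by
  intro k hk v v' lam lam'
  rcases hk.eq_or_lt with rfl | hk
  · have hc : 1 + cSeq a₁ b₁ 1 = bEnd a₁ b₁ 1 / a₁ := by simp [cSeq, bEnd_one b₁ ha]
    rw [hc, Nat.sub_self, hw0]
    exact TnormSq_le_div_mul ha (hw 1 le_rfl) (hw 1 le_rfl) _ _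
  · have hc : 1 + cSeq a₁ b₁ k = bEnd a₁ b₁ (k - 1) / a₁ := by simp [cSeq, hk.ne']
    have hk1 : 1 ≤ k - 1 := by omega
    rw [hc]
    exact TnormSq_le_div_mul ha
      (fun j i => Set.Icc_subset_Icc_right (bEnd_le_bEnd ha hab hk1 (Nat.sub_le k 1))
        (hw k hk.le j i))
      (hw (k - 1) hk1) _ _
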